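/- Let d and r be positive integers such that d is divisible by 2 or by 3. Then there exist infinitely many totally real number fields F of degree d over ℚ with m(F) ≥ r. -/

import Mathlib

open scoped NumberField

def TotallyPositive (F : Type*) [Field F] (x : F) : Prop :=
  ∀ φ : F →+* ℝ, 0 < φ x

def IsTotallyRealField (F : Type*) [Field F] : Prop :=
  ∀ φ : F →+* ℂ, ∀ x : F, (φ x).im = 0

def IsTotPosLattice (F : Type*) [Field F] (r : ℕ)
    (Λ : Submodule (𝓞 F) (Fin r → F)) (Q : QuadraticForm F (Fin r → F)) : Prop :=
  Λ.FG ∧ Submodule.span F (Λ : Set (Fin r → F)) = ⊤ ∧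
    (∀ v ∈ Λ, ∃ a : 𝓞 F, (a : F) = Q v) ∧
    (∀ v : Fin r → F, v ≠ 0 → TotallyPositive F (Q v))

def IsUniversalLattice (F : Type*) [Field F] (r : ℕ)
    (Λ : Submodule (𝓞 F) (Fin r → F)) (Q : QuadraticForm F (Fin r → F)) : Prop :=
  IsTotPosLattice F r Λ Q ∧
    ∀ a : 𝓞 F, TotallyPositive F (a : F) → ∃ v ∈ Λ, Q v = (a : F)

noncomputable def minUnivRank (F : Type*) [Field F] : ℕ :=
  sInf { r | ∃ Λ Q, IsUniversalLattice F r Λ Q }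

section TotallyReal

variable {F : Type*} [Field F]

theorem IsTotallyRealField.exists_ofReal_eq (hF : IsTotallyRealField F) (φ : F →+* ℂ) :
    ∃ ψ : F →+* ℝ, ∀ x, (ψ x : ℂ) = φ x := by
  have key : ∀ x, ((φ x).re : ℂ) = φ x := fun x => Complex.ext rfl (by simp [hF φ x])
  refine ⟨⟨⟨⟨fun x => (φ x).re, by simp⟩, fun x y => ?_⟩, by simp, fun x y => ?_⟩, key⟩
  · simp [hF φ x]
  · simp

variable [NumberField F]

theorem IsTotallyRealField.finite_abs_le (hF : IsTotallyRealField F) (B : ℝ) :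
    {x : 𝓞 F | ∀ φ : F →+* ℝ, |φ x| ≤ B}.Finite := by
  refine Set.Finite.of_finite_image
    ((NumberField.Embeddings.finite_of_norm_le F ℂ B).subset ?_)
    (NumberField.RingOfIntegers.coe_injective (K := F)).injOn
  rintro _ ⟨x, hx, rfl⟩
  refine ⟨x.2, fun φ => ?_⟩
  obtain ⟨ψ, hψ⟩ := hF.exists_ofReal_eq φ
  rw [← hψ, Complex.norm_real]
  exact hx ψ

theorem exists_unit_abs_lt_one (φ : F →+* ℝ) :
    ∃ u : (𝓞 F)ˣ, ∀ ψ : F →+* ℝ, ψ ≠ φ → |ψ (u : 𝓞 F)| < 1 := by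
  let c : (F →+* ℝ) → (F →+* ℂ) := fun ψ => Complex.ofRealHom.comp ψ
  obtain ⟨u, hu⟩ := NumberField.Units.dirichletUnitTheorem.exists_unit F
    (NumberField.InfinitePlace.mk (c φ))
  refine ⟨u, fun ψ hψ => ?_⟩
  have hne : NumberField.InfinitePlace.mk (c ψ) ≠ NumberField.InfinitePlace.mk (c φ) := by
    intro h
    refine hψ (RingHom.ext fun x => ?_)
    rcases NumberField.InfinitePlace.mk_eq_iff.1 h with h | h
    · simpa [c] using congrArg Complex.re (RingHom.congr_fun h x)
    · simpa [c] using congrArg Complex.re (RingHom.congr_fun h x)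
  have h := hu _ hne
  rw [NumberField.InfinitePlace.apply] at h
  have h2 : ‖c ψ ((u : 𝓞 F) : F)‖ = |ψ ((u : 𝓞 F) : F)| := by simp [c]
  rw [h2] at h
  by_contra! hge
  exact absurd (Real.log_nonneg hge) (not_le.2 h)

/-- Every totally positive integer can be multiplied by the square of a unit so that all its
conjugates have the same order of magnitude. -/
theorem IsTotallyRealField.exists_unit_sq_balanced (hF : IsTotallyRealField F) :
    ∃ K : ℝ, 0 < K ∧ ∀ a : 𝓞 F, TotallyPositive F a → ∃ u : (𝓞 F)ˣ,
      ∀ φ ψ : F →+* ℝ, φ ((a * (u : 𝓞 F) ^ 2 : 𝓞 F) : F) ≤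
        K * ψ ((a * (u : 𝓞 F) ^ 2 : 𝓞 F) : F) := by
  classical
  choose w hw using exists_unit_abs_lt_one (F := F)
  let H : 𝓞 F → ℝ := fun a => ‖fun φ : F →+* ℝ => φ (a : F)‖
  have hH : ∀ (a : 𝓞 F) (φ : F →+* ℝ), |φ a| ≤ H a := fun a φ =>
    norm_le_pi_norm (fun φ : F →+* ℝ => φ (a : F)) φ
  let K : ℝ := 1 + ∑ ψ : F →+* ℝ, ψ ((w ψ : 𝓞 F) : F) ^ 2
  have hK : ∀ ψ : F →+* ℝ, ψ ((w ψ : 𝓞 F) : F) ^ 2 ≤ K := fun ψ => by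
    have := Finset.single_le_sum (f := fun ψ : F →+* ℝ => ψ ((w ψ : 𝓞 F) : F) ^ 2)
      (fun i _ => sq_nonneg _) (Finset.mem_univ ψ)
    simp only [K]
    linarith
  refine ⟨K, by positivity, fun a ha => ?_⟩
  let S : Set (𝓞 F) := {b | (∃ u : (𝓞 F)ˣ, b = a * (u : 𝓞 F) ^ 2) ∧ H b ≤ H a}
  have hSfin : S.Finite := (hF.finite_abs_le (H a)).subset
    fun b hb φ => (hH b φ).trans hb.2
  obtain ⟨b, ⟨⟨u, rfl⟩, hba⟩, hmin⟩ :=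
    Set.exists_min_image S H hSfin ⟨a, ⟨1, by simp⟩, le_rfl⟩
  set b := a * (u : 𝓞 F) ^ 2 with hb
  have hbpos : ∀ φ : F →+* ℝ, 0 < φ (b : F) := fun φ => by
    have hu : φ ((u : 𝓞 F) : F) ≠ 0 := by simp
    have := ha φ
    simp only [hb, map_mul, map_pow]
    positivity
  refine ⟨u, fun φ ψ => ((le_abs_self _).trans (hH b φ)).trans ?_⟩
  by_contra! hlt
  have hHb : 0 < H b := (hbpos ψ).trans_le ((le_abs_self _).trans (hH b ψ))
  have hlt' : H (b * (w ψ : 𝓞 F) ^ 2) < H b := by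
    refine (pi_norm_lt_iff hHb).2 fun χ => ?_
    have hc := hbpos χ
    simp only [map_mul, map_pow, Real.norm_eq_abs, abs_mul, abs_pow, abs_of_pos hc, sq_abs]
    by_cases hχ : χ = ψ
    · subst hχ
      refine lt_of_le_of_lt ?_ hlt
      rw [mul_comm]
      exact mul_le_mul_of_nonneg_right (hK χ) hc.le
    · have h1 := hw ψ χ hχ
      have h2 : χ ((w ψ : 𝓞 F) : F) ^ 2 < 1 := by
        rw [← sq_abs]
        exact pow_lt_one₀ (abs_nonneg _) h1 two_ne_zero
      have h3 := (le_abs_self _).trans (hH b χ)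
      nlinarith
  refine absurd (hmin _ ⟨⟨u * w ψ, ?_⟩, hlt'.le.trans hba⟩) (not_le.2 hlt')
  rw [hb, Units.val_mul]
  ring

/-- The totally positive integers all of whose conjugates are at most `B`. -/
def boundedTotPos (F : Type*) [Field F] (B : ℝ) : Set (𝓞 F) :=
  {x | TotallyPositive F (x : F) ∧ ∀ φ : F →+* ℝ, φ x ≤ B}

theorem IsTotallyRealField.finite_boundedTotPos (hF : IsTotallyRealField F) (B : ℝ) :
    (boundedTotPos F B).Finite :=
  (hF.finite_abs_le B).subset fun x hx φ => by
    rw [abs_of_pos (hx.1 φ)]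
    exact hx.2 φ

/-- Totally positive integers with comparable conjugates lie in a finitely generated additive
monoid of totally positive integers. -/
theorem exists_mem_closure_boundedTotPos [Nonempty (F →+* ℝ)] (K : ℝ) :
    ∃ B : ℝ, ∀ a : 𝓞 F, TotallyPositive F a → (∀ φ ψ : F →+* ℝ, φ a ≤ K * ψ a) →
      a ∈ AddSubmonoid.closure (boundedTotPos F B) := by
  classical
  let ι := Module.Free.ChooseBasisIndex ℤ (𝓞 F)
  let ω : Module.Basis ι ℤ (𝓞 F) := NumberField.RingOfIntegers.basis F
  obtain ⟨M, hM⟩ : ∃ M : ℕ, ∀ (j : ι) (φ : F →+* ℝ), |φ (ω j : F)| < M := by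
    obtain ⟨M, hM⟩ := exists_nat_gt (∑ j : ι, ∑ φ : F →+* ℝ, |φ (ω j : F)|)
    refine ⟨M, fun j φ => lt_of_le_of_lt ?_ hM⟩
    exact (Finset.single_le_sum (f := fun φ : F →+* ℝ => |φ (ω j : F)|)
      (fun _ _ => abs_nonneg _) (Finset.mem_univ φ)).trans
      (Finset.single_le_sum (f := fun j : ι => ∑ φ : F →+* ℝ, |φ (ω j : F)|)
      (fun _ _ => Finset.sum_nonneg fun _ _ => abs_nonneg _) (Finset.mem_univ j))
  let d : ℕ := Fintype.card ι
  let c : ℝ := 2 * d * M + 1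
  have hc : 1 ≤ c := by simp only [c]; linarith [show (0 : ℝ) ≤ 2 * d * M by positivity]
  let B : ℝ := |K| * (2 * c) + 2 * M + 1
  refine ⟨B, fun a ha hbal => ?_⟩
  obtain ⟨φ₀, hφ₀⟩ := Finite.exists_min fun φ : F →+* ℝ => φ (a : F)
  set m := φ₀ (a : F) with hm
  have hm0 : 0 < m := ha φ₀
  have hmax : ∀ φ : F →+* ℝ, φ (a : F) ≤ |K| * m := fun φ =>
    (hbal φ φ₀).trans (mul_le_mul_of_nonneg_right (le_abs_self K) hm0.le)
  rcases lt_or_ge m c with hmc | hmc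
  · refine AddSubmonoid.subset_closure ⟨ha, fun φ => (hmax φ).trans ?_⟩
    have : |K| * m ≤ |K| * (2 * c) := by gcongr; linarith
    simp only [B]
    linarith [show (0 : ℝ) ≤ 2 * M by positivity]
  have hMB : (2 * M : ℝ) ≤ B := by
    simp only [B]
    linarith [show (0 : ℝ) ≤ |K| * (2 * c) by positivity]
  have h1B : (1 : ℝ) ≤ B := by
    simp only [B]
    linarith [show (0 : ℝ) ≤ |K| * (2 * c) by positivity, show (0 : ℝ) ≤ 2 * M by positivity]
  let q : ℕ := ⌊m / c⌋₊
  have hc0 : 0 < c := by linarith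
  have hq1 : 1 ≤ q := Nat.le_floor (by rw [Nat.cast_one, le_div_iff₀ hc0]; linarith)
  have hq1' : (1 : ℝ) ≤ q := by exact_mod_cast hq1
  have hqm : q * c ≤ m := by
    rw [← le_div_iff₀ hc0]
    exact Nat.floor_le (by positivity)
  have hmq : m ≤ 2 * c * q := by
    have h := Nat.lt_floor_add_one (m / c)
    rw [div_lt_iff₀ hc0] at h
    have : ((q : ℝ) + 1) * c ≤ 2 * c * q := by nlinarith
    exact h.le.trans this
  let A : ι → ℤ := fun j => ω.repr a j
  let r : ι → ℕ := fun j => (A j % q).toNat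
  have hr : ∀ j, (r j : ℤ) = A j % q := fun j =>
    Int.toNat_of_nonneg (Int.emod_nonneg _ (by omega))
  have hrq : ∀ j, r j ≤ q := fun j => by
    have := Int.emod_lt_of_pos (A j) (show (0 : ℤ) < q by omega)
    have := hr j
    omega
  let b : 𝓞 F := ∑ j, (A j / q) • ω j
  let ρ : 𝓞 F := ∑ j, r j • ω j
  have hab : a = q • b + ρ := by
    conv_lhs => rw [← ω.sum_repr a]
    simp only [b, ρ, Finset.smul_sum, ← Finset.sum_add_distrib]
    refine Finset.sum_congr rfl fun j _ => ?_
    rw [← natCast_zsmul, ← natCast_zsmul, smul_smul, ← add_smul, hr]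
    congr 1
    exact (Int.mul_ediv_add_emod (A j) q).symm
  have hdec : a = q • (b - (d * M : ℕ)) + ∑ j, r j • (ω j + (M : 𝓞 F)) +
      (∑ j, (q - r j) * M) • (1 : 𝓞 F) := by
    have h2 : (∑ j, (q - r j) * M) + (∑ j, r j) * M = q * (d * M) := by
      rw [Finset.sum_mul, ← Finset.sum_add_distrib]
      have : ∀ j ∈ (Finset.univ : Finset ι), (q - r j) * M + r j * M = q * M := fun j _ => by
        rw [← add_mul, Nat.sub_add_cancel (hrq j)]
      rw [Finset.sum_congr rfl this, Finset.sum_const, Finset.card_univ, smul_eq_mul]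
      ring
    have h3 : ((∑ j, (q - r j) * M : ℕ) : 𝓞 F) + (∑ j, (r j : 𝓞 F)) * M = q * (d * M) := by
      exact_mod_cast congrArg (Nat.cast : ℕ → 𝓞 F) h2
    rw [hab]
    simp only [nsmul_eq_mul, ρ, mul_add, Finset.sum_add_distrib, ← Finset.sum_mul, mul_one]
    push_cast at h3 ⊢
    rw [← Finset.sum_mul] at h3
    linear_combination -h3
  have hρ : ∀ φ : F →+* ℝ, |φ (ρ : F)| ≤ q * (d * M) := fun φ => by
    simp only [ρ, map_sum, nsmul_eq_mul, map_mul, map_natCast]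
    refine (Finset.abs_sum_le_sum_abs _ _).trans ?_
    have : ∀ j ∈ (Finset.univ : Finset ι), |(r j : ℝ) * φ (ω j : F)| ≤ q * M := fun j _ => by
      rw [abs_mul, Nat.abs_cast]
      have := hM j φ
      have : (r j : ℝ) ≤ q := by exact_mod_cast hrq j
      gcongr
    refine (Finset.sum_le_sum this).trans ?_
    rw [Finset.sum_const, Finset.card_univ, nsmul_eq_mul]
    exact le_of_eq (by ring)
  have hφa : ∀ φ : F →+* ℝ, φ (a : F) = q * φ (b : F) + φ (ρ : F) := fun φ => by
    conv_lhs => rw [hab]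
    simp
  rw [hdec]
  refine add_mem (add_mem (nsmul_mem (AddSubmonoid.subset_closure ?_) _) (sum_mem fun j _ =>
    nsmul_mem (AddSubmonoid.subset_closure ?_) _)) (nsmul_mem (AddSubmonoid.subset_closure ?_) _)
  · have key : ∀ φ : F →+* ℝ, φ ((b - ((d * M : ℕ) : 𝓞 F) : 𝓞 F) : F) = φ (b : F) - d * M :=
      fun φ => by simp
    constructor
    · intro φ
      rw [key]
      have h1 := hφa φ
      have h2 := (abs_le.1 (hρ φ)).2
      have h3 := hφ₀ φ
      by_contra! h4
      have h5 : (q : ℝ) * φ (b : F) ≤ q * (d * M) := by gcongr; linarith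
      have h6 : (q : ℝ) * c = 2 * (q * (d * M)) + q := by simp only [c]; ring
      linarith
    · intro φ
      rw [key]
      have h1 := hφa φ
      have h2 := (abs_le.1 (hρ φ)).1
      have h3 := hmax φ
      have h4 : |K| * m ≤ |K| * (2 * c * q) := by gcongr
      by_contra! h5
      have h6 : (q : ℝ) * (B + d * M) < q * φ (b : F) := by gcongr; linarith
      have h7 : (q : ℝ) * (B + d * M) = |K| * (2 * c * q) + q * (d * M) + q * (2 * M + 1) := by
        simp only [B]
        ring
      have h8 : (0 : ℝ) ≤ q * (2 * M + 1) := by positivity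
      linarith
  · have key : ∀ φ : F →+* ℝ, φ ((ω j + (M : 𝓞 F) : 𝓞 F) : F) = φ (ω j : F) + M :=
      fun φ => by simp
    constructor
    · intro φ
      rw [key]
      linarith [(abs_lt.1 (hM j φ)).1]
    · intro φ
      rw [key]
      linarith [(abs_lt.1 (hM j φ)).2]
  · exact ⟨fun φ => by simp, fun φ => by simpa using h1B⟩

/-- Over a totally real field, there is a universal diagonal form. -/
theorem IsTotallyRealField.exists_isUniversalLattice (hF : IsTotallyRealField F)
    [Nonempty (F →+* ℝ)] :
    ∃ (r : ℕ) (Λ : Submodule (𝓞 F) (Fin r → F)) (Q : QuadraticForm F (Fin r → F)),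
      IsUniversalLattice F r Λ Q := by
  classical
  obtain ⟨K, -, hK⟩ := hF.exists_unit_sq_balanced
  obtain ⟨B, hB⟩ := exists_mem_closure_boundedTotPos (F := F) K
  let s : Finset (𝓞 F) := (hF.finite_boundedTotPos B).toFinset
  have hs : ∀ x ∈ s, TotallyPositive F (x : F) := fun x hx =>
    ((hF.finite_boundedTotPos B).mem_toFinset.1 hx).1
  obtain ⟨r, ⟨e⟩⟩ : ∃ r, Nonempty (Fin r ≃ s × Fin 4) := ⟨_, ⟨(Fintype.equivFin _).symm⟩⟩
  let L : (Fin r → 𝓞 F) →ₗ[𝓞 F] (Fin r → F) := (Algebra.linearMap (𝓞 F) F).compLeft (Fin r)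
  have hL : ∀ x i, L x i = (x i : F) := fun _ _ => rfl
  let w : Fin r → F := fun i => ((e i).1 : 𝓞 F)
  have hw : ∀ i, TotallyPositive F (w i) := fun i => hs _ (e i).1.2
  let Q : QuadraticForm F (Fin r → F) := QuadraticMap.weightedSumSquares F w
  have hQ : ∀ v, Q v = ∑ i, w i * (v i * v i) := fun v => by
    simp [Q, QuadraticMap.weightedSumSquares_apply]
  refine ⟨r, LinearMap.range L, Q, ⟨?_, ?_, ?_, ?_⟩, ?_⟩
  · exact (Module.Finite.iff_fg).1 inferInstance
  · rw [eq_top_iff, ← (Pi.basisFun F (Fin r)).span_eq, Submodule.span_le]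
    rintro _ ⟨i, rfl⟩
    refine Submodule.subset_span ⟨Pi.single i 1, ?_⟩
    ext j
    rw [hL, Pi.basisFun_apply]
    by_cases h : j = i
    · subst h; simp
    · simp [h]
  · rintro _ ⟨x, rfl⟩
    refine ⟨∑ i, ((e i).1 : 𝓞 F) * (x i * x i), ?_⟩
    rw [hQ, NumberField.RingOfIntegers.coe_eq_algebraMap, map_sum]
    simp only [map_mul]
    rfl
  · intro v hv φ
    rw [hQ, map_sum]
    obtain ⟨i, hi⟩ := Function.ne_iff.1 hv
    refine Finset.sum_pos' (fun j _ => ?_) ⟨i, Finset.mem_univ i, ?_⟩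
    · rw [map_mul, map_mul]
      exact mul_nonneg (hw j φ).le (mul_self_nonneg _)
    · rw [map_mul, map_mul]
      exact mul_pos (hw i φ) (mul_self_pos.2 ((map_ne_zero φ).2 hi))
  · intro a ha
    obtain ⟨u, hu⟩ := hK a ha
    have hau : TotallyPositive F ((a * (u : 𝓞 F) ^ 2 : 𝓞 F) : F) := fun φ => by
      have hu : φ ((u : 𝓞 F) : F) ≠ 0 := by simp
      have := ha φ
      simp only [map_mul, map_pow]
      positivity
    have hmem := hB _ hau hu
    rw [← (hF.finite_boundedTotPos B).coe_toFinset] at hmem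
    obtain ⟨f, -, hf⟩ := AddSubmonoid.mem_closure_finset.1 hmem
    have hfour : ∀ n : ℕ, ∃ g : Fin 4 → ℕ, ∑ k, g k * g k = n := fun n => by
      obtain ⟨x, y, z, t, h⟩ := Nat.sum_four_squares n
      refine ⟨![x, y, z, t], ?_⟩
      rw [← h]
      simp [Fin.sum_univ_four]
      ring
    choose g hg using hfour
    let v : Fin r → 𝓞 F := fun i => ((u⁻¹ : (𝓞 F)ˣ) : 𝓞 F) * (g (f (e i).1) (e i).2 : 𝓞 F)
    refine ⟨L v, ⟨v, rfl⟩, ?_⟩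
    let G : s × Fin 4 → 𝓞 F := fun p => (p.1 : 𝓞 F) * ((g (f p.1) p.2 : 𝓞 F) * g (f p.1) p.2)
    have h1 : ∑ i, ((e i).1 : 𝓞 F) * (v i * v i) = a := by
      have h2 : ∀ i, ((e i).1 : 𝓞 F) * (v i * v i) = ((u⁻¹ : (𝓞 F)ˣ) : 𝓞 F) ^ 2 * G (e i) :=
        fun i => by
          simp only [v, G]
          ring
      rw [Finset.sum_congr rfl fun i _ => h2 i, ← Finset.mul_sum, e.sum_comp G,
        Fintype.sum_prod_type]
      have h3 : ∀ x : s, ∑ k, (x : 𝓞 F) * ((g (f x) k : 𝓞 F) * g (f x) k) = f x • (x : 𝓞 F) :=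
        fun x => by
          rw [← Finset.mul_sum, nsmul_eq_mul, mul_comm]
          congr 1
          exact_mod_cast congrArg (Nat.cast : ℕ → 𝓞 F) (hg (f x))
      simp only [G, h3]
      rw [Finset.sum_coe_sort s fun x => f x • x, hf]
      have : ((u⁻¹ : (𝓞 F)ˣ) : 𝓞 F) * (u : 𝓞 F) = 1 := by simp
      linear_combination a * (((u⁻¹ : (𝓞 F)ˣ) : 𝓞 F) * (u : 𝓞 F) + 1) * this
    rw [hQ, ← h1, NumberField.RingOfIntegers.coe_eq_algebraMap, map_sum]
    simp only [map_mul]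
    rfl

theorem exists_sub_eq_three_smul {r n : ℕ} {Λ : Submodule (𝓞 F) (Fin r → F)} (hΛ : Λ.FG)
    (hn : 3 ^ (Module.finrank ℚ F * r) < n) (v : Fin n → Λ) :
    ∃ i j, i ≠ j ∧ ∃ w : Λ, v i - v j = (3 : ℤ) • w := by
  classical
  have : Module.Finite (𝓞 F) Λ := Module.Finite.iff_fg.2 hΛ
  have : Module.Finite ℤ Λ := Module.Finite.trans (𝓞 F) Λ
  have : Module.Free ℤ Λ := inferInstance
  let ι := Module.Free.ChooseBasisIndex ℤ Λ
  let b : Module.Basis ι ℤ Λ := Module.Free.chooseBasis ℤ Λ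
  have hli : LinearIndependent ℤ fun i => (b i : Fin r → F) :=
    b.linearIndependent.map' (Λ.subtype.restrictScalars ℤ) (LinearMap.ker_eq_bot.2
      Subtype.val_injective)
  have hli' : LinearIndependent ℚ fun i => (b i : Fin r → F) :=
    (LinearIndependent.iff_fractionRing ℤ ℚ).1 hli
  have hcard : Fintype.card ι ≤ Module.finrank ℚ F * r := by
    refine hli'.fintype_card_le_finrank.trans (le_of_eq ?_)
    rw [Module.finrank_pi_fintype]
    simp [mul_comm]
  let c : Fin n → (ι → ZMod 3) := fun i k => (b.repr (v i) k : ZMod 3)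
  obtain ⟨i, j, hij, hc⟩ := Fintype.exists_ne_map_eq_of_card_lt c (by
    rw [Fintype.card_fun, ZMod.card, Fintype.card_fin]
    exact (Nat.pow_le_pow_right (by norm_num) hcard).trans_lt hn)
  have hdvd : ∀ k, (3 : ℤ) ∣ b.repr (v i - v j) k := fun k => by
    have h := congrFun hc k
    rw [map_sub, Finsupp.sub_apply]
    exact (ZMod.intCast_eq_intCast_iff_dvd_sub _ _ 3).1 h.symm
  choose g hg using hdvd
  refine ⟨i, j, hij, ∑ k, g k • b k, ?_⟩
  rw [← b.sum_repr (v i - v j), Finset.smul_sum]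
  exact Finset.sum_congr rfl fun k _ => by rw [hg, mul_smul]

/-- If the signature of a unit `η` is negative at exactly one real embedding, and no integer
with the same signature has all its conjugates smaller than `n`, then a universal lattice has
large rank in terms of `n`. -/
theorem IsTotallyRealField.not_isUniversalLattice (hF : IsTotallyRealField F) {n r : ℕ}
    (hn : 3 ^ (Module.finrank ℚ F * r) < n) (η : (𝓞 F)ˣ) (φ₀ : F →+* ℝ)
    (hη₀ : φ₀ (η : 𝓞 F) < 0) (hη : ∀ φ : F →+* ℝ, φ ≠ φ₀ → 0 < φ (η : 𝓞 F))
    (hbad : ∀ z : 𝓞 F, φ₀ z < 0 → (∀ φ : F →+* ℝ, φ ≠ φ₀ → 0 < φ z) →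
      ∃ φ : F →+* ℝ, (n : ℝ) ≤ |φ z|)
    (Λ : Submodule (𝓞 F) (Fin r → F)) (Q : QuadraticForm F (Fin r → F)) :
    ¬ IsUniversalLattice F r Λ Q := by
  classical
  rintro ⟨⟨hfg, -, hint, hpos⟩, huniv⟩
  have hn0 : (0 : ℝ) < n := by exact_mod_cast (Nat.zero_le _).trans_lt hn
  let T : (F →+* ℝ) → ℝ := fun φ => n * |φ ((η : 𝓞 F) : F)|
  have hη' : ∀ φ : F →+* ℝ, 0 < |φ ((η : 𝓞 F) : F)| := fun φ => abs_pos.2 (by simp)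
  have hT : ∀ φ, 0 < T φ := fun φ => mul_pos hn0 (hη' φ)
  have hsmall : ∀ a : 𝓞 F, TotallyPositive F (a : F) → (∀ φ, φ ≠ φ₀ → φ a < T φ) →
      T φ₀ ≤ φ₀ a := by
    intro a ha hlt
    by_contra! h0
    let z : 𝓞 F := a * ((η⁻¹ : (𝓞 F)ˣ) : 𝓞 F)
    have hz : ∀ φ : F →+* ℝ, φ (z : F) = φ (a : F) / φ ((η : 𝓞 F) : F) := fun φ => by
      have h1 : z * (η : 𝓞 F) = a := by simp [z]
      rw [eq_div_iff (abs_pos.1 (hη' φ)), ← map_mul, ← h1]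
      simp
    obtain ⟨φ, hφ⟩ := hbad z (by rw [hz]; exact div_neg_of_pos_of_neg (ha _) hη₀)
      fun φ hφ => by rw [hz]; exact div_pos (ha _) (hη φ hφ)
    rw [hz, abs_div, le_div_iff₀ (hη' φ), abs_of_pos (ha φ)] at hφ
    have : φ (a : F) < T φ := by
      by_cases h : φ = φ₀
      · rw [h]; exact h0
      · exact hlt φ h
    exact absurd hφ (not_le.2 this)
  obtain ⟨a, ha, haT⟩ : ∃ a : 𝓞 F, TotallyPositive F (a : F) ∧ ∀ φ, φ ≠ φ₀ → φ a < T φ := by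
    obtain ⟨u, hu⟩ := exists_unit_abs_lt_one φ₀
    have h1 : ∀ φ : F →+* ℝ, ∀ᶠ m : ℕ in Filter.atTop,
        φ ≠ φ₀ → (φ ((u : 𝓞 F) : F) ^ 2) ^ m < T φ := fun φ => by
      by_cases h : φ = φ₀
      · simp [h]
      · have h2 : φ ((u : 𝓞 F) : F) ^ 2 < 1 := by
          rw [← sq_abs]
          exact pow_lt_one₀ (abs_nonneg _) (hu φ h) two_ne_zero
        filter_upwards [(tendsto_pow_atTop_nhds_zero_of_lt_one (sq_nonneg _) h2).eventually
          (gt_mem_nhds (hT φ))] with m hm _ using hm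
    obtain ⟨m, hm⟩ := (Filter.eventually_all.2 h1).exists
    refine ⟨((u : 𝓞 F) ^ 2) ^ m, fun φ => ?_, fun φ hφ => ?_⟩
    · have : φ ((u : 𝓞 F) : F) ≠ 0 := by simp
      simp only [map_pow]
      positivity
    · simpa using hm φ hφ
  let S : Set (𝓞 F) :=
    {b | TotallyPositive F (b : F) ∧ (∀ φ, φ ≠ φ₀ → φ b < T φ) ∧ φ₀ b ≤ φ₀ a}
  have hSfin : S.Finite := by
    refine (hF.finite_abs_le (∑ φ, T φ + φ₀ a)).subset fun b hb φ => ?_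
    rw [abs_of_pos (hb.1 φ)]
    have h1 := ha φ₀
    have h2 : T φ ≤ ∑ φ, T φ :=
      Finset.single_le_sum (fun φ _ => (hT φ).le) (Finset.mem_univ φ)
    have h3 := hT φ
    by_cases h : φ = φ₀
    · subst h
      linarith [hb.2.2]
    · linarith [hb.2.1 φ h]
  obtain ⟨b, ⟨hb, hbT, hba⟩, hmin⟩ :=
    Set.exists_min_image S (fun b => φ₀ (b : F)) hSfin ⟨a, ha, haT, le_rfl⟩
  have hb₀ := hsmall b hb hbT
  let x : Fin n → 𝓞 F := fun l => b + (l : ℕ) * (η : 𝓞 F)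
  have hx : ∀ l (φ : F →+* ℝ), φ (x l : F) = φ (b : F) + (l : ℕ) * φ ((η : 𝓞 F) : F) :=
    fun l φ => by simp [x]
  have hln : ∀ l : Fin n, ((l : ℕ) : ℝ) < n := fun l => by exact_mod_cast l.2
  have hxpos : ∀ l, TotallyPositive F (x l : F) := fun l φ => by
    rw [hx]
    by_cases h : φ = φ₀
    · subst h
      have h1 : ((l : ℕ) : ℝ) * |φ ((η : 𝓞 F) : F)| < n * |φ ((η : 𝓞 F) : F)| := by
        have := hη' φ
        have := hln l
        gcongr
      rw [abs_of_neg hη₀] at h1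
      simp only [T, abs_of_neg hη₀] at hb₀
      linarith
    · have := hη φ h
      have := hb φ
      positivity
  have hx₀ : ∀ l, φ₀ (x l : F) ≤ φ₀ (b : F) := fun l => by
    rw [hx]
    have := mul_nonneg (Nat.cast_nonneg (α := ℝ) (l : ℕ)) (neg_pos.2 hη₀).le
    linarith
  have hxT : ∀ l (φ : F →+* ℝ), φ ≠ φ₀ → φ (x l : F) < 2 * T φ := fun l φ hφ => by
    rw [hx]
    have h1 := hbT φ hφ
    have h2 : ((l : ℕ) : ℝ) * φ ((η : 𝓞 F) : F) ≤ T φ := by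
      simp only [T]
      have := hln l
      have := hη φ hφ
      rw [abs_of_pos (hη φ hφ)]
      gcongr
    linarith
  have hxinj : Function.Injective x := fun i j hij => by
    have h := congrArg (fun y : 𝓞 F => φ₀ (y : F)) hij
    simp only [hx] at h
    have h1 := mul_right_cancel₀ (abs_pos.1 (hη' φ₀)) (add_left_cancel h)
    exact Fin.ext (by exact_mod_cast h1)
  choose v hvΛ hv using fun l => huniv (x l) (hxpos l)
  obtain ⟨i, j, hij, w, hw⟩ := exists_sub_eq_three_smul hfg hn fun l => (⟨v l, hvΛ l⟩ : Λ)
  have hw' : v i - v j = (3 : F) • (w : Fin r → F) := by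
    have := congrArg (Subtype.val : Λ → Fin r → F) hw
    simp only [Submodule.coe_sub] at this
    rw [this]
    ext k
    simp
  have hvij : v i ≠ v j := fun h => hij (hxinj (NumberField.RingOfIntegers.coe_injective
    ((hv i).symm.trans ((congrArg Q h).trans (hv j)))))
  have hw0 : (w : Fin r → F) ≠ 0 := fun h => hvij (sub_eq_zero.1 (by rw [hw', h, smul_zero]))
  obtain ⟨y, hy⟩ := hint w w.2
  have hypos : TotallyPositive F (y : F) := by rw [hy]; exact hpos _ hw0
  have hle : ∀ φ : F →+* ℝ, 9 * φ (y : F) ≤ 2 * φ (x i : F) + 2 * φ (x j : F) := by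
    intro φ
    have h1 : Q (v i - v j) = 9 * y := by
      rw [hw', QuadraticMap.map_smul, hy, smul_eq_mul]
      norm_num
    have h2 : Q (v i + v j) + Q (v i - v j) = 2 * x i + 2 * x j := by
      have h3 := QuadraticMap.map_add Q (v i) (v j)
      have h4 := QuadraticMap.map_add Q (v i) (-v j)
      rw [QuadraticMap.map_neg, QuadraticMap.polar_neg_right, ← sub_eq_add_neg] at h4
      rw [h3, h4, hv, hv]
      ring
    have h5 : 0 ≤ φ (Q (v i + v j)) := by
      by_cases h : v i + v j = 0
      · simp [h]
      · exact (hpos _ h φ).le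
    have h6 := congrArg φ h2
    rw [h1] at h6
    simp only [map_add, map_mul, map_ofNat] at h6
    linarith
  have hyT : ∀ φ, φ ≠ φ₀ → φ (y : F) < T φ := fun φ hφ => by
    linarith [hle φ, hxT i φ hφ, hxT j φ hφ, hT φ]
  have hy₀ : φ₀ (y : F) < φ₀ (b : F) := by
    linarith [hle φ₀, hx₀ i, hx₀ j, hb φ₀]
  exact absurd (hmin y ⟨hypos, hyT, hy₀.le.trans hba⟩) (not_le.2 hy₀)

end TotallyReal

open Polynomial

theorem Polynomial.exists_prime_not_dvd_dvd_eval (h : ℤ[X]) (hh : 0 < h.natDegree) (M : ℤ)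
    (hM : M ≠ 0) : ∃ p : ℕ, p.Prime ∧ ¬ (p : ℤ) ∣ M ∧ ∃ x : ℤ, (p : ℤ) ∣ h.eval x := by
  set c := h.eval 0 with hc
  rcases eq_or_ne c 0 with h0 | h0
  · obtain ⟨p, hp, hp'⟩ := Nat.exists_infinite_primes (M.natAbs + 1)
    refine ⟨p, hp', fun hd => ?_, 0, by rw [← hc, h0]; exact dvd_zero _⟩
    have := Nat.le_of_dvd (Int.natAbs_pos.2 hM) (Int.natCast_dvd.1 hd)
    omega
  have hne : ∀ a : ℤ, h - C a ≠ 0 := fun a ha => by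
    rw [sub_eq_zero.1 ha, natDegree_C] at hh
    exact lt_irrefl _ hh
  have hfin : {x : ℤ | h.eval x = c ∨ h.eval x = -c}.Finite := by
    refine (((h - C c) * (h - C (-c))).rootSet_finite ℤ).subset fun x hx => ?_
    rw [mem_rootSet]
    refine ⟨mul_ne_zero (hne _) (hne _), ?_⟩
    rcases hx with hx | hx <;> simp [hx]
  have hinj : Function.Injective fun t : ℤ => c * M * t := fun a b hab =>
    mul_left_cancel₀ (mul_ne_zero h0 hM) hab
  obtain ⟨t, ht⟩ : ∃ t : ℤ, ¬ (h.eval (c * M * t) = c ∨ h.eval (c * M * t) = -c) := by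
    by_contra! hall
    exact (Set.infinite_range_of_injective hinj) (hfin.subset (by rintro _ ⟨t, rfl⟩; exact hall t))
  obtain ⟨k, hk⟩ := sub_dvd_eval_sub (c * M * t) 0 h
  have hk' : h.eval (c * M * t) = c * (1 + M * t * k) := by
    rw [← hc] at hk
    linear_combination hk
  have hu : (1 + M * t * k).natAbs ≠ 1 := fun hu => ht <| by
    rcases Int.natAbs_eq_iff.1 hu with hu | hu <;> rw [hk', hu] <;> simp
  obtain ⟨p, hp, hpd⟩ := Nat.exists_prime_and_dvd hu
  refine ⟨p, hp, fun hd => ?_, c * M * t, ?_⟩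
  · have h1 : (p : ℤ) ∣ 1 :=
      (Int.dvd_iff_dvd_of_dvd_add (by simpa using Int.natCast_dvd.2 hpd)).2
        (Dvd.dvd.mul_right (Dvd.dvd.mul_right hd _) _)
    exact hp.one_lt.ne' (by exact_mod_cast Int.eq_one_of_dvd_one (by positivity) h1)
  · rw [hk']
    exact Dvd.dvd.mul_left (Int.natCast_dvd.2 hpd) _

/-- A number field has a prime with a place of degree one, so that integral equations solvable in
the field are solvable modulo that prime. -/
theorem NumberField.exists_prime_forall_root (E : Type*) [Field E] [NumberField E] :
    ∃ p : ℕ, p.Prime ∧ ∀ f : ℤ[X], f.Monic → (∃ x : E, aeval x f = 0) →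
      ∃ y : ZMod p, aeval y f = 0 := by
  obtain ⟨α, hα⟩ := Field.exists_primitive_element ℚ E
  obtain ⟨y, hy, hyint⟩ := ((IsFractionRing.isAlgebraic_iff ℤ ℚ E).2
    (Algebra.IsAlgebraic.isAlgebraic α)).exists_integral_multiple
  set θ := y • α with hθ
  have hθtop : Algebra.adjoin ℚ {θ} = ⊤ := by
    rw [← IntermediateField.adjoin_simple_toSubalgebra_of_isAlgebraic
      (Algebra.IsAlgebraic.isAlgebraic θ), ← IntermediateField.top_toSubalgebra, ← hα]
    congr 1
    refine le_antisymm (IntermediateField.adjoin_simple_le_iff.2 ?_)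
      (IntermediateField.adjoin_simple_le_iff.2 ?_)
    · exact zsmul_mem (IntermediateField.mem_adjoin_simple_self ℚ α) y
    · have h := IntermediateField.smul_mem _ (IntermediateField.mem_adjoin_simple_self ℚ θ)
        (x := (y : ℚ)⁻¹)
      have hα' : (y : ℚ)⁻¹ • θ = α := by
        rw [hθ, ← Int.cast_smul_eq_zsmul ℚ, smul_smul,
          inv_mul_cancel₀ (Int.cast_ne_zero.2 hy), one_smul]
      rwa [hα'] at h
  let B : PowerBasis ℚ E := PowerBasis.ofAdjoinEqTop (Algebra.IsIntegral.isIntegral θ) hθtop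
  have hB : B.gen = θ := PowerBasis.ofAdjoinEqTop_gen _ _
  obtain ⟨M, hM⟩ := IsIntegrallyClosed.isIntegral_iff.1
    (Algebra.discr_isIntegral (R := ℤ) ℚ (b := B.basis) fun i => by
      rw [B.basis_eq_pow, hB]
      exact hyint.pow _)
  have hM0 : M ≠ 0 := by
    rintro rfl
    exact Algebra.discr_not_zero_of_basis ℚ B.basis (by rw [← hM, map_zero])
  obtain ⟨p, hp, hpM, x, hx⟩ := (minpoly ℤ θ).exists_prime_not_dvd_dvd_eval
    (minpoly.natDegree_pos hyint) M hM0
  have : Fact p.Prime := ⟨hp⟩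
  let ψ : Algebra.adjoin ℤ {θ} →ₐ[ℤ] ZMod p :=
    (Algebra.adjoin.powerBasis' hyint).lift (x : ZMod p) <| by
      rw [← Algebra.adjoin.powerBasis'_minpoly_gen hyint, ← eq_intCast (algebraMap ℤ (ZMod p)),
        aeval_algebraMap_apply, coe_aeval_eq_eval, eq_intCast,
        ZMod.intCast_zmod_eq_zero_iff_dvd]
      exact hx
  refine ⟨p, hp, fun f hf ⟨z, hz⟩ => ?_⟩
  have hzint : IsIntegral ℤ z := ⟨f, hf, hz⟩
  have hmem := Algebra.discr_mul_isIntegral_mem_adjoin ℚ (B := B) (hB ▸ hyint) hzint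
  rw [hB, ← hM, algebraMap_smul] at hmem
  have hroot : aeval (⟨M • z, hmem⟩ : Algebra.adjoin ℤ {θ}) (f.scaleRoots M) = 0 := by
    apply Subtype.val_injective
    have := scaleRoots_aeval_eq_zero (r := M) hz
    rw [← Algebra.smul_def] at this
    simpa [← Subalgebra.coe_val, ← aeval_algHom_apply] using this
  have hMp : (M : ZMod p) ≠ 0 := fun h => hpM ((ZMod.intCast_zmod_eq_zero_iff_dvd _ _).1 h)
  have hψ := congrArg ψ hroot
  rw [map_zero, ← aeval_algHom_apply] at hψ
  refine ⟨ψ ⟨M • z, hmem⟩ / M, ?_⟩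
  have h := scaleRoots_eval₂_mul_of_commute (p := f) (algebraMap ℤ (ZMod p))
    (ψ ⟨M • z, hmem⟩ / M) M (Commute.all _ _) fun _ _ => Commute.all _ _
  rw [eq_intCast, mul_div_cancel₀ _ hMp] at h
  exact (mul_eq_zero.1 (h.symm.trans hψ)).resolve_left (pow_ne_zero _ hMp)

theorem ZMod.exists_forall_pow_mul_sub_add_ne_zero (p : ℕ) [Fact p.Prime] {k : ℕ} (hk : k ≠ 0)
    {c : ZMod p} (hc : c ≠ 0) : ∃ a : ZMod p, ∀ x : ZMod p, x ^ k * (x - a) + c ≠ 0 := by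
  by_contra! h
  choose x hx using h
  have hx0 : ∀ a, x a ≠ 0 := fun a h0 => hc <| by
    simpa [h0, hk] using hx a
  have hinj : Function.Injective x := fun a b hab => by
    have h1 := hx a
    rw [hab] at h1
    have h2 := mul_left_cancel₀ (pow_ne_zero k (hx0 b)) (add_right_cancel (h1.trans (hx b).symm))
    exact sub_right_injective h2
  obtain ⟨a, ha⟩ := (Finite.injective_iff_surjective.1 hinj) 0
  exact hx0 a ha

theorem Polynomial.exists_root_of_eval_mul_neg (f : ℝ[X]) {a b : ℝ} (hab : a < b)
    (h : f.eval a * f.eval b < 0) : ∃ c ∈ Set.Ioo a b, f.eval c = 0 := by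
  rcases mul_neg_iff.1 h with ⟨ha, hb⟩ | ⟨ha, hb⟩
  · exact intermediate_value_Ioo' hab.le f.continuous.continuousOn ⟨hb, ha⟩
  · exact intermediate_value_Ioo hab.le f.continuous.continuousOn ⟨ha, hb⟩

theorem one_le_neg_one_pow_mul_prod (b : ℕ → ℤ) (y : ℤ) (j : ℕ) (h1 : ∀ i < j, 1 ≤ y - b i)
    (h2 : ∀ i ≥ j, 1 ≤ b i - y) (n : ℕ) (hn : j ≤ n) :
    1 ≤ (-1) ^ (n + j) * ∏ i ∈ Finset.range n, (y - b i) := by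
  induction n, hn using Nat.le_induction with
  | base =>
    rw [Even.neg_one_pow ⟨j, rfl⟩, one_mul]
    exact Multiset.one_le_prod fun x hx => by
      obtain ⟨i, hi, rfl⟩ := Multiset.mem_map.1 hx
      exact h1 i (Finset.mem_range.1 hi)
  | succ n hn ih =>
    have h := h2 n hn
    rw [Finset.prod_range_succ, show n + 1 + j = n + j + 1 by ring, pow_succ]
    nlinarith

/-- A monic integral polynomial which has one negative root and large positive roots, and whose
constant term is a unit. -/
noncomputable def oneNegativeRoot (e : ℕ) (b : ℕ → ℤ) : ℤ[X] :=
  X * ∏ i ∈ Finset.range (e + 1), (X - C (b i)) + C ((-1) ^ (e + 1))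

section OneNegativeRoot

variable (e : ℕ) (b : ℕ → ℤ)

theorem natDegree_X_mul_prod_range_X_sub_C :
    (X * ∏ i ∈ Finset.range (e + 1), (X - C (b i))).natDegree = e + 2 := by
  rw [natDegree_X_mul (monic_prod_X_sub_C _ _).ne_zero, natDegree_finsetProd_X_sub_C_eq_card,
    Finset.card_range]

theorem natDegree_oneNegativeRoot : (oneNegativeRoot e b).natDegree = e + 2 := by
  rw [oneNegativeRoot, natDegree_add_C, natDegree_X_mul_prod_range_X_sub_C]

theorem monic_oneNegativeRoot : (oneNegativeRoot e b).Monic := by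
  refine (monic_X.mul (monic_prod_X_sub_C _ _)).add_of_left (degree_C_le.trans_lt ?_)
  rw [← natDegree_pos_iff_degree_pos, natDegree_X_mul_prod_range_X_sub_C]
  omega

theorem eval_oneNegativeRoot (x : ℤ) : (oneNegativeRoot e b).eval x =
    x * ∏ i ∈ Finset.range (e + 1), (x - b i) + (-1) ^ (e + 1) := by
  simp [oneNegativeRoot, eval_prod]

theorem coeff_zero_oneNegativeRoot : (oneNegativeRoot e b).coeff 0 = (-1) ^ (e + 1) := by
  rw [coeff_zero_eq_eval_zero, eval_oneNegativeRoot, zero_mul, zero_add]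

theorem aeval_oneNegativeRoot_ne_zero {p : ℕ} {a : ZMod p}
    (ha : ∀ x : ZMod p, x ^ (e + 1) * (x - a) + (-1) ^ (e + 1) ≠ 0)
    (h0 : (b 0 : ZMod p) = a) (hb : ∀ i, (b (i + 1) : ZMod p) = 0) (x : ZMod p) :
    aeval x (oneNegativeRoot e b) ≠ 0 := by
  have h := ha x
  contrapose! h
  rw [← h]
  simp only [oneNegativeRoot, map_add, map_mul, map_prod, map_sub, aeval_X, eq_intCast, map_intCast,
    map_pow,
    map_neg, map_one, Finset.prod_range_succ', h0, hb, sub_zero, Finset.prod_const,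
    Finset.card_range]
  ring

variable {b}

theorem exists_roots_oneNegativeRoot (h0 : 3 ≤ b 0) (hb : ∀ i, b i + 2 ≤ b (i + 1)) :
    ∃ η : ℝ, ∃ s : Multiset ℝ,
    -1 < η ∧ η < 0 ∧ (∀ x ∈ s, 2 < x) ∧ Multiset.card s = e + 1 ∧
      ((oneNegativeRoot e b).map (Int.castRingHom ℝ)).roots = η ::ₘ s := by
  set f := oneNegativeRoot e b with hf
  set g := f.map (Int.castRingHom ℝ)
  have hgf : ∀ x : ℤ, g.eval (x : ℝ) = f.eval x := fun x => by
    exact eval_intCast_map (Int.castRingHom ℝ) f x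
  have hmono : Monotone b := monotone_nat_of_le_succ fun i => by linarith [hb i]
  obtain ⟨y, hy0, hys⟩ : ∃ y : ℕ → ℤ, y 0 = 2 ∧ ∀ i, y (i + 1) = b i + 1 :=
    ⟨fun j => Nat.casesOn j 2 fun i => b i + 1, rfl, fun _ => rfl⟩
  have hy2 : ∀ j, 2 ≤ y j := fun j => by
    cases j with
    | zero => exact hy0.ge
    | succ i =>
      have := hmono (Nat.zero_le i)
      rw [hys]
      omega
  have hyb : ∀ j, y j + 1 ≤ b j := fun j => by
    cases j with
    | zero => linarith
    | succ i => linarith [hys i, hb i]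
  have hy : StrictMono y := strictMono_nat_of_lt_succ fun j => by
    linarith [hys j, hyb j]
  have hsign : ∀ j ≤ e + 1, 0 < (-1) ^ (e + 1 + j) * f.eval (y j) := fun j hj => by
    have h := one_le_neg_one_pow_mul_prod b (y j) j
      (fun i hi => by
        have h1 : y (i + 1) ≤ y j := hy.monotone hi
        have h2 := hys i
        linarith)
      (fun i hi => by linarith [hyb j, hmono hi]) (e + 1) hj
    rw [hf, eval_oneNegativeRoot, mul_add, mul_left_comm, ← pow_add (-1 : ℤ),
      show e + 1 + j + (e + 1) = 2 * (e + 1) + j by ring, pow_add _ (2 * _), pow_mul,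
      neg_one_sq, one_pow,
      one_mul]
    have h3 : -1 ≤ (-1 : ℤ) ^ j := by rcases neg_one_pow_eq_or ℤ j with h | h <;> simp [h]
    nlinarith [hy2 j]
  have hroot : ∀ j : ℕ, ∃ x : ℝ, j ≤ e →
      x ∈ Set.Ioo ((y j : ℤ) : ℝ) ((y (j + 1) : ℤ) : ℝ) ∧ g.eval x = 0 := by
    intro j
    by_cases hj : j ≤ e
    · have h1 := mul_pos (hsign j (by omega)) (hsign (j + 1) (by omega))
      have h2 : f.eval (y j) * f.eval (y (j + 1)) < 0 := by
        have : ((-1 : ℤ) ^ (e + 1 + j)) ^ 2 = 1 := by rw [← pow_mul, mul_comm, pow_mul]; simp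
        rw [← add_assoc, pow_succ] at h1
        linear_combination h1 - this * f.eval (y j) * f.eval (y (j + 1))
      obtain ⟨x, hx, hx'⟩ := g.exists_root_of_eval_mul_neg
        (Int.cast_lt.2 (hy (Nat.lt_succ_self j)))
        (by rw [hgf, hgf]; exact_mod_cast h2)
      exact ⟨x, fun _ => ⟨hx, hx'⟩⟩
    · exact ⟨0, fun h => absurd h hj⟩
  choose ρ hρ using hroot
  obtain ⟨η, ⟨hη1, hη0⟩, hη⟩ : ∃ η ∈ Set.Ioo (-1 : ℝ) 0, g.eval η = 0 := by
    refine g.exists_root_of_eval_mul_neg (by norm_num) ?_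
    have h1 := one_le_neg_one_pow_mul_prod b (-1) 0 (by simp)
      (fun i _ => by linarith [hmono (Nat.zero_le i)]) e (Nat.zero_le _)
    have h2 : f.eval (-1) * f.eval 0 < 0 := by
      rw [hf, eval_oneNegativeRoot, eval_oneNegativeRoot, Finset.prod_range_succ]
      have h3 : ((-1 : ℤ) ^ e) ^ 2 = 1 := by rw [← pow_mul, mul_comm, pow_mul]; simp
      rw [add_zero] at h1
      have h4 := hmono (Nat.zero_le e)
      rw [pow_succ]
      nlinarith
    have := hgf (-1)
    have h3 := hgf 0
    push_cast at this h3
    rw [this, h3]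
    exact_mod_cast h2
  have hρmono : StrictMonoOn ρ (Set.Iic e) := fun i hi j hj hij =>
    (hρ i hi).1.2.trans_le ((Int.cast_le.2 (hy.monotone hij)).trans (hρ j hj).1.1.le)
  have hρ2 : ∀ i ≤ e, 2 < ρ i := fun i hi =>
    lt_of_le_of_lt (by exact_mod_cast hy2 i) (hρ i hi).1.1
  let S := (Finset.range (e + 1)).image ρ
  have hS2 : ∀ x ∈ S, 2 < x := fun x hx => by
    obtain ⟨i, hi, rfl⟩ := Finset.mem_image.1 hx
    exact hρ2 i (Nat.lt_succ_iff.1 (Finset.mem_range.1 hi))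
  have hScard : S.card = e + 1 := by
    rw [Finset.card_image_of_injOn, Finset.card_range]
    exact hρmono.injOn.mono fun i hi => Nat.lt_succ_iff.1 (Finset.mem_range.1 hi)
  have hηS : η ∉ S := fun h => by linarith [hS2 η h]
  refine ⟨η, S.1, hη1, hη0, hS2, hScard, ?_⟩
  have hgm : g.Monic := (monic_oneNegativeRoot e b).map _
  rw [← Finset.cons_val hηS]
  refine roots_eq_of_natDegree_le_card_of_ne_zero ?_ ?_ hgm.ne_zero
  · intro x hx
    rcases Finset.mem_cons.1 hx with rfl | hx
    · exact hη
    · obtain ⟨i, hi, rfl⟩ := Finset.mem_image.1 hx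
      exact (hρ i (Nat.lt_succ_iff.1 (Finset.mem_range.1 hi))).2
  · rw [Finset.card_cons, hScard, (monic_oneNegativeRoot e b).natDegree_map,
      natDegree_oneNegativeRoot]

end OneNegativeRoot

theorem Polynomial.minpoly_eq_of_roots_eq_cons {f : ℤ[X]} (hf : f.Monic)
    (h0 : IsUnit (f.coeff 0)) (hsplit : (f.map (Int.castRingHom ℝ)).Splits) {η : ℝ}
    {s : Multiset ℝ} (hs : ∀ x ∈ s, 1 < x)
    (hroots : (f.map (Int.castRingHom ℝ)).roots = η ::ₘ s) : minpoly ℤ η = f := by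
  set ι := Int.castRingHom ℝ
  have hη : aeval η f = 0 := by
    have h : η ∈ (f.map ι).roots := hroots ▸ Multiset.mem_cons_self η s
    rw [mem_roots (hf.map _).ne_zero, IsRoot, eval_map] at h
    exact h
  have hint : IsIntegral ℤ η := ⟨f, hf, hη⟩
  obtain ⟨h, hh⟩ := minpoly.isIntegrallyClosed_dvd hint hη
  have hm := minpoly.monic hint
  have hhm : h.Monic := hm.of_mul_monic_left (hh ▸ hf)
  have hne : (minpoly ℤ η).map ι * h.map ι ≠ 0 := ((hm.map ι).mul (hhm.map ι)).ne_zero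
  have hhs : (h.map ι).Splits := hsplit.of_dvd (hf.map ι).ne_zero
    (map_dvd ι ⟨_, hh.trans (mul_comm _ _)⟩)
  have hηm : η ∈ ((minpoly ℤ η).map ι).roots := by
    rw [mem_roots (hm.map _).ne_zero, IsRoot, eval_map]
    exact minpoly.aeval ℤ η
  obtain ⟨t, ht⟩ := Multiset.exists_cons_of_mem hηm
  rw [hh, Polynomial.map_mul, roots_mul hne, ht, Multiset.cons_add, Multiset.cons_inj_right]
    at hroots
  have hh1 : ∀ x ∈ (h.map ι).roots, 1 < x := fun x hx =>
    hs x (hroots ▸ Multiset.mem_add.2 (Or.inr hx))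
  have hu : IsUnit (h.coeff 0) := by
    rw [hh, mul_coeff_zero] at h0
    exact isUnit_of_mul_isUnit_right h0
  have hprod : |(h.map ι).roots.prod| = 1 := by
    have h1 := congrArg abs (hhs.coeff_zero_eq_prod_roots_of_monic (hhm.map ι))
    rw [abs_mul, abs_pow, abs_neg, abs_one, one_pow, one_mul] at h1
    rw [← h1, coeff_map]
    rcases Int.isUnit_iff.1 hu with hu | hu <;> simp [hu]
  have hcard : (h.map ι).roots = 0 := by
    by_contra hne
    obtain ⟨x, hx⟩ := Multiset.exists_mem_of_ne_zero hne
    obtain ⟨t, ht⟩ := Multiset.exists_cons_of_mem hx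
    rw [ht] at hprod hh1
    have h1 : 1 ≤ t.prod :=
      Multiset.one_le_prod fun y hy => (hh1 y (Multiset.mem_cons_of_mem hy)).le
    rw [Multiset.prod_cons] at hprod
    have h2 := hh1 x (Multiset.mem_cons_self _ _)
    rw [abs_of_pos (by positivity)] at hprod
    nlinarith
  have hdeg : h.natDegree = 0 := by
    rw [← hhm.natDegree_map ι, hhs.natDegree_eq_card_roots, hcard, Multiset.card_zero]
  rw [hhm.natDegree_eq_zero.1 hdeg, mul_one] at hh
  exact hh.symm

open IntermediateField

/-- There is a unit of any degree at least two which has real conjugates, only one of them negative,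
and whose minimal polynomial has no root modulo `p`. -/
theorem exists_oneNegativeRoot (p e : ℕ) [Fact p.Prime] : ∃ η : ℝ, IsIntegral ℤ η ∧ η < 0 ∧
    (minpoly ℤ η).natDegree = e + 2 ∧ IsUnit ((minpoly ℤ η).coeff 0) ∧
    ((minpoly ℤ η).map (Int.castRingHom ℝ)).Splits ∧
    (∀ x : ℝ, aeval x (minpoly ℤ η) = 0 → x = η ∨ 0 < x) ∧
    ∀ x : ZMod p, aeval x (minpoly ℤ η) ≠ 0 := by
  obtain ⟨a, ha⟩ := ZMod.exists_forall_pow_mul_sub_add_ne_zero p (Nat.succ_ne_zero e)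
    (pow_ne_zero (e + 1) (neg_ne_zero.2 (one_ne_zero (α := ZMod p))))
  have hp := (Fact.out : p.Prime).two_le
  have hap := a.val_lt
  let b : ℕ → ℤ := fun i => 4 * p * (i + 1) + if i = 0 then (a.val : ℤ) else 0
  have h0 : 3 ≤ b 0 := by
    have : (0 : ℤ) ≤ a.val := Int.natCast_nonneg _
    simp only [b, if_true, Nat.cast_zero, zero_add]
    linarith [(Nat.cast_le (α := ℤ)).2 hp, Nat.cast_ofNat (R := ℤ) (n := 2)]
  have hb : ∀ i, b i + 2 ≤ b (i + 1) := fun i => by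
    have : (if i = 0 then (a.val : ℤ) else 0) ≤ p := by split_ifs <;> omega
    simp only [b, Nat.succ_ne_zero, if_false]
    push_cast
    nlinarith
  obtain ⟨η, s, -, hη, hs, hcard, hroots⟩ := exists_roots_oneNegativeRoot e h0 hb
  have hf := monic_oneNegativeRoot e b
  have hdeg := natDegree_oneNegativeRoot e b
  have hunit : IsUnit ((oneNegativeRoot e b).coeff 0) := by
    rw [coeff_zero_oneNegativeRoot]
    exact (isUnit_one.neg).pow _
  have hsplit : ((oneNegativeRoot e b).map (Int.castRingHom ℝ)).Splits := by
    rw [splits_iff_card_roots, hroots, hf.natDegree_map, hdeg, Multiset.card_cons, hcard]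
  have hmem : ∀ x : ℝ, aeval x (oneNegativeRoot e b) = 0 ↔ x = η ∨ x ∈ s := fun x => by
    rw [← Multiset.mem_cons, ← hroots, mem_roots (hf.map _).ne_zero, IsRoot, eval_map]
    rfl
  have hmin := minpoly_eq_of_roots_eq_cons hf hunit hsplit
    (fun x hx => one_lt_two.trans (hs x hx)) hroots
  refine ⟨η, ⟨_, hf, (hmem η).2 (Or.inl rfl)⟩, hη, ?_⟩
  rw [hmin]
  refine ⟨hdeg, hunit, hsplit, fun x hx => ((hmem x).1 hx).imp_right fun h =>
    two_pos.trans (hs x h), aeval_oneNegativeRoot_ne_zero e b ha ?_ ?_⟩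
  · simp [b]
  · simp [b]

/-- Finitely many algebraic integers have bounded conjugates in some real field of degree `d`. -/
theorem exists_finite_bounded_conjugates (d : ℕ) (B : ℝ) : ∃ Z : Set ℝ, Z.Finite ∧
    (∀ x ∈ Z, IsIntegral ℤ x) ∧ ∀ (F : IntermediateField ℚ ℝ) [NumberField F],
      Module.finrank ℚ F = d → ∀ x : F, IsIntegral ℤ x → (∀ φ : F →+* ℂ, ‖φ x‖ ≤ B) →
        (x : ℝ) ∈ Z := by
  classical
  let C := ⌈max B 1 ^ d * d.choose (d / 2)⌉₊
  have hfin := bUnion_roots_finite (algebraMap ℤ ℝ) d (Set.finite_Icc (-C : ℤ) C)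
  refine ⟨_, hfin.inter_of_left {x | IsIntegral ℤ x}, fun x hx => hx.2, ?_⟩
  rintro F _ rfl x hint hx
  refine ⟨?_, hint.algebraMap⟩
  have hmin := minpoly.isIntegrallyClosed_eq_field_fractions' ℚ hint
  simp_rw [Set.mem_iUnion]
  refine ⟨minpoly ℤ x, ⟨?_, fun i => ?_⟩, ?_⟩
  · rw [← (minpoly.monic hint).natDegree_map (algebraMap ℤ ℚ), ← hmin]
    exact minpoly.natDegree_le x
  · rw [Set.mem_Icc, ← abs_le, ← @Int.cast_le ℝ]
    refine (Eq.trans_le ?_ <| NumberField.Embeddings.coeff_bdd_of_norm_le hx i).trans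
      (Nat.le_ceil _)
    rw [hmin, coeff_map, eq_intCast, Int.norm_cast_rat, Int.norm_eq_abs, Int.cast_abs]
  · refine mem_rootSet.2 ⟨minpoly.ne_zero hint, ?_⟩
    rw [show (x : ℝ) = algebraMap F ℝ x from rfl, aeval_algebraMap_apply, minpoly.aeval, map_zero]

theorem Polynomial.isUnit_of_aeval_eq_zero {R A : Type*} [CommRing R] [CommRing A] [Algebra R A]
    {x : A} {f : R[X]} (hx : aeval x f = 0) (hf : IsUnit (f.coeff 0)) : IsUnit x := by
  rw [← f.divX_mul_X_add, map_add, map_mul, aeval_X, aeval_C] at hx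
  refine isUnit_of_mul_isUnit_right (x := aeval x f.divX) ?_
  rw [eq_neg_of_add_eq_zero_left hx]
  exact (hf.map (algebraMap R A)).neg

theorem aeval_map_gen_minpoly (η : ℝ) {R : Type*} [CommRing R] (φ : ℚ⟮η⟯ →+* R) :
    aeval (φ (AdjoinSimple.gen ℚ η)) (minpoly ℤ η) = 0 := by
  have h : minpoly ℤ η = minpoly ℤ (AdjoinSimple.gen ℚ η) := by
    rw [← minpoly.algebraMap_eq (algebraMap ℚ⟮η⟯ ℝ).injective, AdjoinSimple.algebraMap_gen]
  rw [h]
  exact (aeval_algHom_apply φ.toIntAlgHom _ _).trans (by rw [minpoly.aeval, map_zero])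

theorem ringHom_adjoin_ext {η : ℝ} {K : Type*} [Field K] [CharZero K] {φ ψ : ℚ⟮η⟯ →+* K}
    (h : φ (AdjoinSimple.gen ℚ η) = ψ (AdjoinSimple.gen ℚ η)) : φ = ψ := by
  have hφ : φ.toRatAlgHom = ψ.toRatAlgHom :=
    algHom_ext_of_eq_adjoin ℚ rfl fun y hy => by
      obtain rfl := Set.mem_singleton_iff.1 hy
      exact h
  exact RingHom.ext fun x => DFunLike.congr_fun hφ x

theorem isTotallyRealField_adjoin {η : ℝ} (hint : IsIntegral ℤ η)
    (hsplit : ((minpoly ℤ η).map (Int.castRingHom ℝ)).Splits) : IsTotallyRealField ℚ⟮η⟯ := by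
  intro φ x
  have hgen : (starRingEnd ℂ) (φ (AdjoinSimple.gen ℚ η)) = φ (AdjoinSimple.gen ℚ η) := by
    have h : φ (AdjoinSimple.gen ℚ η) ∈ ((minpoly ℤ η).map (Int.castRingHom ℂ)).roots := by
      rw [mem_roots ((minpoly.monic hint).map _).ne_zero, IsRoot, eval_map]
      exact aeval_map_gen_minpoly η φ
    rw [← (RingHom.ext_int (Complex.ofRealHom.comp (Int.castRingHom ℝ)) (Int.castRingHom ℂ)),
      ← Polynomial.map_map, hsplit.roots_map] at h
    obtain ⟨y, -, hy⟩ := Multiset.mem_map.1 h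
    rw [← hy]
    exact Complex.conj_ofReal y
  have hφ : (starRingEnd ℂ).comp φ = φ := ringHom_adjoin_ext hgen
  exact Complex.conj_eq_iff_im.1 (RingHom.congr_fun hφ x)

theorem IsTotallyRealField.mem_adjoin_simple {F : Type*} [Field F] [NumberField F]
    (hF : IsTotallyRealField F) (φ₀ : F →+* ℝ) {z : F} (h : ∀ φ : F →+* ℝ, φ z = φ₀ z → φ = φ₀)
    (y : F) : φ₀ y ∈ ℚ⟮φ₀ z⟯ := by
  have htop : ℚ⟮z⟯ = ⊤ := by
    refine (Field.primitive_element_iff_algHom_eq_of_eval ℚ ℂ (fun _ => IsAlgClosed.splits _) z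
      (Complex.ofRealHom.comp φ₀).toRatAlgHom).2 fun ψ hψ => ?_
    obtain ⟨φ, hφ⟩ := hF.exists_ofReal_eq (ψ : F →+* ℂ)
    have := h φ (Complex.ofReal_injective ((hφ z).trans hψ.symm))
    subst this
    exact AlgHom.ext fun x => hφ x
  have hmap : ℚ⟮z⟯.map φ₀.toRatAlgHom = ℚ⟮φ₀ z⟯ := by
    rw [adjoin_map, Set.image_singleton]
    rfl
  rw [← hmap, htop]
  exact ⟨y, trivial, rfl⟩

/-- There are totally real fields with a unit that is negative at exactly one real place, in which
every integer with the signature of that unit has a large conjugate. -/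
theorem exists_totallyReal_adjoin (e : ℕ) (B : ℝ) : ∃ F : IntermediateField ℚ ℝ,
    IsTotallyRealField F ∧ Module.finrank ℚ F = e + 2 ∧ ∃ u : (𝓞 F)ˣ,
      algebraMap F ℝ (u : 𝓞 F) < 0 ∧ (∀ φ ≠ algebraMap F ℝ, 0 < φ (u : 𝓞 F)) ∧
      ∀ z : 𝓞 F, algebraMap F ℝ z < 0 → (∀ φ ≠ algebraMap F ℝ, 0 < φ z) →
        ∃ φ : F →+* ℝ, B ≤ |φ z| := by
  obtain ⟨Z, hZfin, hZint, hZ⟩ := exists_finite_bounded_conjugates (e + 2) B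
  let E := IntermediateField.adjoin ℚ Z
  have := hZfin.to_subtype
  have : FiniteDimensional ℚ E := finiteDimensional_adjoin fun x hx => (hZint x hx).tower_top
  have : NumberField E := ⟨⟩
  obtain ⟨p, hp, hpE⟩ := NumberField.exists_prime_forall_root E
  have := Fact.mk hp
  obtain ⟨η, hint, hη, hdeg, hunit, hsplit, hroots, hmod⟩ := exists_oneNegativeRoot p e
  have hintQ : IsIntegral ℚ η := hint.tower_top
  have : FiniteDimensional ℚ ℚ⟮η⟯ := adjoin.finiteDimensional hintQ
  have : NumberField ℚ⟮η⟯ := ⟨⟩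
  have hF := isTotallyRealField_adjoin hint hsplit
  have hfr : Module.finrank ℚ ℚ⟮η⟯ = e + 2 := by
    rw [adjoin.finrank hintQ, minpoly.isIntegrallyClosed_eq_field_fractions' ℚ hint,
      (minpoly.monic hint).natDegree_map, hdeg]
  have hgen := aeval_map_gen_minpoly η (RingHom.id _)
  let w : 𝓞 ℚ⟮η⟯ := ⟨AdjoinSimple.gen ℚ η, _, minpoly.monic hint, hgen⟩
  have hw : IsUnit w := isUnit_of_aeval_eq_zero (f := minpoly ℤ η)
    (NumberField.RingOfIntegers.coe_injective <| by
      rw [map_zero, ← aeval_algebraMap_apply]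
      exact hgen) hunit
  refine ⟨ℚ⟮η⟯, hF, hfr, hw.unit, hη, fun φ hφ => ?_, fun z hz hz' => ?_⟩
  · refine (hroots _ (aeval_map_gen_minpoly η φ)).resolve_left fun h => hφ ?_
    exact ringHom_adjoin_ext h
  · by_contra! hB
    have hzZ : ((z : ℚ⟮η⟯) : ℝ) ∈ Z := hZ _ hfr _ z.2 fun φ => by
      obtain ⟨ψ, hψ⟩ := hF.exists_ofReal_eq φ
      rw [← hψ, Complex.norm_real]
      exact (hB ψ).le
    have hηE : η ∈ E :=
      adjoin_simple_le_iff.2 (subset_adjoin ℚ Z hzZ) <|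
        hF.mem_adjoin_simple (algebraMap _ ℝ) (z := z) (fun φ hφ => by
          by_contra hne
          exact absurd (hz' φ hne) (hφ ▸ hz.not_gt)) (AdjoinSimple.gen ℚ η)
    obtain ⟨y, hy⟩ := hpE _ (minpoly.monic hint) ⟨⟨η, hηE⟩, by
      apply (algebraMap E ℝ).injective
      rw [← aeval_algebraMap_apply, map_zero]
      exact minpoly.aeval ℤ η⟩
    exact hmod y hy

theorem exists_le_minUnivRank (e r : ℕ) : ∃ F : IntermediateField ℚ ℝ,
    IsTotallyRealField F ∧ Module.finrank ℚ F = e + 2 ∧ r ≤ minUnivRank F := by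
  obtain ⟨F, hF, hfr, u, hu, hu', hbad⟩ :=
    exists_totallyReal_adjoin e ((3 ^ ((e + 2) * r) + 1 : ℕ) : ℝ)
  have : FiniteDimensional ℚ F := Module.finite_of_finrank_pos (by omega)
  have : NumberField F := ⟨⟩
  have : Nonempty (F →+* ℝ) := ⟨algebraMap F ℝ⟩
  refine ⟨F, hF, hfr, le_csInf hF.exists_isUniversalLattice ?_⟩
  rintro r' ⟨Λ, Q, h⟩
  by_contra! hlt
  refine hF.not_isUniversalLattice ?_ u _ hu hu' hbad Λ Q h
  rw [hfr]
  exact Nat.lt_succ_of_le (Nat.pow_le_pow_right (by norm_num) (Nat.mul_le_mul_left _ hlt.le))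

theorem deg_div_two_or_three (d r : ℕ) (hd : 0 < d) (hr : 0 < r)
    (hdiv : 2 ∣ d ∨ 3 ∣ d) :
    {F : IntermediateField ℚ ℝ | IsTotallyRealField F ∧
      Module.finrank ℚ F = d ∧ r ≤ minUnivRank ↥F}.Infinite := by
  obtain ⟨e, rfl⟩ : ∃ e, d = e + 2 := ⟨d - 2, by omega⟩
  intro hfin
  obtain ⟨N, hN⟩ := (hfin.image fun F : IntermediateField ℚ ℝ => minUnivRank F).bddAbove
  obtain ⟨F, hF, hfr, hle⟩ := exists_le_minUnivRank e (max r (N + 1))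
  have hFN : minUnivRank F ≤ N := hN ⟨F, ⟨hF, hfr, (le_max_left _ _).trans hle⟩, rfl⟩
  exact absurd ((le_max_right _ _).trans hle) (Nat.lt_succ_of_le hFN).not_ge
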